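/- For every Fano plane F on {1,2,3,4,5,6,7}, the tuple (n0, n1, n2, n3), where ns is the number of points of order s in F, is one of exactly the following eight tuples: (0,0,0,7), (4,3,0,0), (0,0,3,4), (0,1,4,2), (1,3,3,0), (0,3,3,1), (0,6,0,1), (1,0,6,0); moreover each of these eight tuples is realized by some Fano plane on {1,...,7}. -/

import Mathlib

/-- The point set {1,...,7}. -/
def pts : Finset ℕ := Finset.Icc 1 7

/-- All three-element subsets of {1,...,7}, the candidate lines. -/
def lines : Finset (Finset ℕ) := pts.powersetCard 3

/-- A line {a,b,c} with a < b < c is ordinary if a + b = c. -/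
def Ordinary (l : Finset ℕ) : Prop :=
  ∃ a ∈ l, ∃ b ∈ l, ∃ c ∈ l, a < b ∧ b < c ∧ a + b = c

instance : DecidablePred Ordinary := fun l => by unfold Ordinary; infer_instance

/-- A line is defective if it is not ordinary. -/
def Defective (l : Finset ℕ) : Prop := ¬ Ordinary l

instance : DecidablePred Defective := fun l => by unfold Defective; infer_instance

/-- A Fano plane on {1,...,7}: seven 3-element subsets such that every pair of
distinct points lies on exactly one line. -/
def IsFano (F : Finset (Finset ℕ)) : Prop :=
  F ⊆ lines ∧ F.card = 7 ∧
    ∀ p ∈ pts, ∀ q ∈ pts, p ≠ q →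
      (F.filter (fun l => p ∈ l ∧ q ∈ l)).card = 1

instance : DecidablePred IsFano := fun F => by unfold IsFano; infer_instance

/-- The collection of all Fano planes on {1,...,7}. -/
def fanos : Finset (Finset (Finset ℕ)) := (lines.powersetCard 7).filter IsFano

/-- The order of a point p in a plane F: the number of defective lines of F through p. -/
def order (F : Finset (Finset ℕ)) (p : ℕ) : ℕ :=
  (F.filter (fun l => Defective l ∧ p ∈ l)).card

/-- The number of points of order s in the plane F. -/
def nOrd (F : Finset (Finset ℕ)) (s : ℕ) : ℕ :=
  (pts.filter (fun p => order F p = s)).card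

/-- `ForallCompletions P ps S` holds if `P` is true of every family of lines obtained from `S` by
adding, for each pair of points in `ps` in turn, a line through that pair which meets every other
line chosen so far in at most one point. -/
def ForallCompletions (P : Finset (Finset ℕ) → Prop) :
    List (ℕ × ℕ) → Finset (Finset ℕ) → Prop
  | [], S => P S
  | pq :: ps, S => ∀ l ∈ lines, pq.1 ∈ l ∧ pq.2 ∈ l → (∀ m ∈ S, m ≠ l → (m ∩ l).card ≤ 1) →
      ForallCompletions P ps (insert l S)

instance ForallCompletions.decidable (P : Finset (Finset ℕ) → Prop) [DecidablePred P] :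
    ∀ ps S, Decidable (ForallCompletions P ps S)
  | [], S => inferInstanceAs (Decidable (P S))
  | pq :: ps, S =>
    haveI : ∀ S, Decidable (ForallCompletions P ps S) := ForallCompletions.decidable P ps
    inferInstanceAs (Decidable (∀ l ∈ lines, pq.1 ∈ l ∧ pq.2 ∈ l →
      (∀ m ∈ S, m ≠ l → (m ∩ l).card ≤ 1) → ForallCompletions P ps (insert l S)))

lemma IsFano.card_inter_le_one {F : Finset (Finset ℕ)} (hF : IsFano F) {l m : Finset ℕ}
    (hl : l ∈ F) (hm : m ∈ F) (hne : m ≠ l) : (m ∩ l).card ≤ 1 := by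
  by_contra! h
  obtain ⟨p, hp, q, hq, hpq⟩ := Finset.one_lt_card.1 h
  rw [Finset.mem_inter] at hp hq
  have hsub := (Finset.mem_powersetCard.1 (hF.1 hl)).1
  refine hne (Finset.card_le_one.1 (hF.2.2 p (hsub hp.2) q (hsub hq.2) hpq).le m ?_ l ?_)
  · exact Finset.mem_filter.2 ⟨hm, hp.1, hq.1⟩
  · exact Finset.mem_filter.2 ⟨hl, hp.2, hq.2⟩

lemma IsFano.exists_completion {F : Finset (Finset ℕ)} (hF : IsFano F)
    {P : Finset (Finset ℕ) → Prop} (ps : List (ℕ × ℕ))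
    (hps : ∀ pq ∈ ps, pq.1 ∈ pts ∧ pq.2 ∈ pts ∧ pq.1 ≠ pq.2) (S : Finset (Finset ℕ))
    (hS : S ⊆ F) (h : ForallCompletions P ps S) : ∃ T ⊆ F, P T := by
  induction ps generalizing S with
  | nil => exact ⟨S, hS, h⟩
  | cons pq ps ih =>
    obtain ⟨hp, hq, hne⟩ := hps pq List.mem_cons_self
    obtain ⟨l, hl⟩ := Finset.card_pos.1 ((hF.2.2 _ hp _ hq hne).symm ▸ one_pos)
    obtain ⟨hlF, hpql⟩ := Finset.mem_filter.1 hl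
    exact ih (fun x hx => hps x (List.mem_cons_of_mem _ hx)) (insert l S)
      (Finset.insert_subset hlF hS)
      (h l (hF.1 hlF) hpql fun m hm => hF.card_inter_le_one hlF (hS hm))

/-- The pairs of points of `{1,...,6}`; every line of a Fano plane on `{1,...,7}` contains one. -/
def spanningPairs : List (ℕ × ℕ) :=
  [(1, 2), (1, 3), (1, 4), (1, 5), (1, 6), (2, 3), (2, 4), (2, 5), (2, 6),
   (3, 4), (3, 5), (3, 6), (4, 5), (4, 6), (5, 6)]

lemma forallCompletions_spanningPairs :
    ForallCompletions (fun T => 7 ≤ T.card ∧ (nOrd T 0, nOrd T 1, nOrd T 2, nOrd T 3) ∈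
      [(0,0,0,7), (4,3,0,0), (0,0,3,4), (0,1,4,2),
       (1,3,3,0), (0,3,3,1), (0,6,0,1), (1,0,6,0)]) spanningPairs ∅ := by
  decide +kernel

theorem order_distribution_classification :
    (∀ F : Finset (Finset ℕ), IsFano F →
      (nOrd F 0, nOrd F 1, nOrd F 2, nOrd F 3) ∈
        [(0,0,0,7), (4,3,0,0), (0,0,3,4), (0,1,4,2),
         (1,3,3,0), (0,3,3,1), (0,6,0,1), (1,0,6,0)]) ∧
    (∀ t ∈ [((0:ℕ),(0:ℕ),(0:ℕ),(7:ℕ)), (4,3,0,0), (0,0,3,4), (0,1,4,2),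
         (1,3,3,0), (0,3,3,1), (0,6,0,1), (1,0,6,0)],
      ∃ F : Finset (Finset ℕ), IsFano F ∧
        (nOrd F 0, nOrd F 1, nOrd F 2, nOrd F 3) = t) := by
  refine ⟨fun F hF => ?_, ?_⟩
  · obtain ⟨T, hTF, hT, h⟩ :=
      hF.exists_completion spanningPairs (by decide) ∅ F.empty_subset
        forallCompletions_spanningPairs
    rwa [← Finset.eq_of_subset_of_card_le hTF (hF.2.1.trans_le hT)]
  · simp only [List.forall_mem_cons, List.not_mem_nil, IsEmpty.forall_iff, implies_true, and_true]
    refine ⟨⟨{{1, 2, 4}, {1, 3, 6}, {1, 5, 7}, {2, 3, 7}, {2, 5, 6}, {3, 4, 5}, {4, 6, 7}}, ?_⟩,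
      ⟨{{1, 2, 3}, {1, 4, 5}, {1, 6, 7}, {2, 4, 6}, {2, 5, 7}, {3, 4, 7}, {3, 5, 6}}, ?_⟩,
      ⟨{{1, 2, 3}, {1, 4, 6}, {1, 5, 7}, {2, 4, 7}, {2, 5, 6}, {3, 4, 5}, {3, 6, 7}}, ?_⟩,
      ⟨{{1, 2, 3}, {1, 4, 6}, {1, 5, 7}, {2, 4, 5}, {2, 6, 7}, {3, 4, 7}, {3, 5, 6}}, ?_⟩,
      ⟨{{1, 2, 3}, {1, 4, 7}, {1, 5, 6}, {2, 4, 6}, {2, 5, 7}, {3, 4, 5}, {3, 6, 7}}, ?_⟩,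
      ⟨{{1, 2, 5}, {1, 3, 4}, {1, 6, 7}, {2, 3, 7}, {2, 4, 6}, {3, 5, 6}, {4, 5, 7}}, ?_⟩,
      ⟨{{1, 2, 7}, {1, 3, 4}, {1, 5, 6}, {2, 3, 5}, {2, 4, 6}, {3, 6, 7}, {4, 5, 7}}, ?_⟩,
      ⟨{{1, 2, 3}, {1, 4, 5}, {1, 6, 7}, {2, 4, 7}, {2, 5, 6}, {3, 4, 6}, {3, 5, 7}}, ?_⟩⟩
    all_goals decide +kernel
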